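/- Let ℓ ≥ 4 be even, s ≥ 0, k = (ℓ−2)/2, and r ≥ 2. For all sufficiently large n, every n-vertex B(ℓ,s)-free graph G contains at most k·binom(n−1,r) + (n−k)·binom(k,r) copies of the star S_r, with equality if and only if G is isomorphic to H(k,n). -/

import Mathlib

open scoped Classical
open Finset SimpleGraph

/-- The broom `B(ℓ,s)`: a path on vertices `0,…,ℓ-1` plus `s` extra leaves
`ℓ,…,ℓ+s-1` attached to the penultimate vertex `ℓ-2` of the path. -/
def broom (ℓ s : ℕ) : SimpleGraph (Fin (ℓ + s)) :=
  SimpleGraph.fromRel (fun a b => (a.val + 1 = b.val ∧ b.val < ℓ) ∨ (a.val = ℓ - 2 ∧ ℓ ≤ b.val))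

/-- `G` contains no subgraph isomorphic to the broom `B(ℓ,s)`. -/
def BroomFree (ℓ s : ℕ) {V : Type*} (G : SimpleGraph V) : Prop :=
  ¬ ∃ f : broom ℓ s →g G, Function.Injective f

/-- `H(k,n)`: the complete bipartite graph `K_{k,n-k}` with all edges added inside
the part `{0,…,k-1}` of size `k`. -/
noncomputable def Hgraph (k n : ℕ) : SimpleGraph (Fin n) :=
  SimpleGraph.fromRel (fun a b => a.val < k ∨ b.val < k)

/-- The number of copies of the star `S_r` in `G`, i.e. the number of choices of a
center vertex together with an `r`-element subset of its neighborhood. -/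
noncomputable def starCopyCount {V : Type*} [Fintype V] (G : SimpleGraph V) (r : ℕ) : ℕ :=
  (Finset.univ.filter (fun p : V × Finset V => p.2.card = r ∧ ∀ x ∈ p.2, G.Adj p.1 x)).card


section Embedding

variable {V : Type*} {G : SimpleGraph V} {ℓ s : ℕ}

/-- A path on `ℓ - 1` vertices whose last vertex has large degree extends to a broom. -/
theorem not_broomFree_of_path [Fintype V] {p : List V} (hne : p ≠ []) (hchain : p.IsChain G.Adj)
    (hnodup : p.Nodup) (hlen : p.length + 1 = ℓ)
    (hdeg : ℓ + s ≤ #{w | G.Adj (p.getLast hne) w}) : ¬ BroomFree ℓ s G := by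
  intro hfree
  apply hfree
  have hcard : s + 1 ≤ #(({w | G.Adj (p.getLast hne) w} : Finset V) \ p.toFinset) := by
    have h1 := Finset.le_card_sdiff p.toFinset ({w | G.Adj (p.getLast hne) w} : Finset V)
    have h2 := List.toFinset_card_le p
    omega
  obtain ⟨Q, hQ, hQcard⟩ := Finset.exists_subset_card_eq hcard
  have hQadj : ∀ x ∈ Q.toList, G.Adj (p.getLast hne) x := by
    intro x hx
    have := hQ (Finset.mem_toList.1 hx)
    simp at this
    exact this.1
  have hall : (p ++ Q.toList).Nodup := by
    rw [List.nodup_append]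
    refine ⟨hnodup, Finset.nodup_toList _, ?_⟩
    rintro a ha b hb rfl
    have := hQ (Finset.mem_toList.1 hb)
    simp at this
    exact this.2 ha
  have htot : (p ++ Q.toList).length = ℓ + s := by
    simp [hQcard]; omega
  have hp0 : 0 < p.length := List.length_pos_iff.2 hne
  have hstep : ∀ (a b : ℕ) (ha : a < (p ++ Q.toList).length) (hb : b < (p ++ Q.toList).length),
      ((a + 1 = b ∧ b < ℓ) ∨ (a = ℓ - 2 ∧ ℓ ≤ b)) →
      G.Adj (p ++ Q.toList)[a] (p ++ Q.toList)[b] := by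
    intro a b ha hb h
    by_cases hbp : b < p.length
    · have hab : a + 1 = b := by omega
      subst hab
      rw [List.getElem_append_left (by omega), List.getElem_append_left hbp]
      exact List.isChain_iff_getElem.1 hchain a hbp
    · have hal : a = p.length - 1 := by omega
      subst hal
      rw [List.getElem_append_left (by omega), List.getElem_append_right (by omega),
        ← List.getLast_eq_getElem hne]
      exact hQadj _ (List.getElem_mem _)
  refine ⟨⟨fun i => (p ++ Q.toList)[i.val]'(by rw [htot]; exact i.2), ?_⟩, ?_⟩
  · intro a b hab
    rw [broom, SimpleGraph.fromRel_adj] at hab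
    rcases hab.2 with h | h
    · exact hstep _ _ _ _ h
    · exact (hstep _ _ _ _ h).symm
  · intro a b hab
    exact Fin.ext ((List.Nodup.getElem_inj_iff hall).1 hab)

theorem exists_path_of_minDegree {U : Finset V} {D : ℕ} (hU : U.Nonempty)
    (hdeg : ∀ v ∈ U, D ≤ #{w ∈ U | G.Adj v w}) (j : ℕ) (hj : j < D) :
    ∃ p : List V, p.length = j + 1 ∧ p.IsChain G.Adj ∧ p.Nodup ∧ ∀ x ∈ p, x ∈ U := by
  induction j with
  | zero =>
    obtain ⟨v, hv⟩ := hU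
    exact ⟨[v], by simp [hv]⟩
  | succ j ih =>
    obtain ⟨p, hlen, hchain, hnodup, hmem⟩ := ih (by omega)
    match p, hlen with
    | v :: q, hlen =>
      have h1 := hdeg v (hmem v (by simp))
      have h2 := List.toFinset_card_le (v :: q)
      obtain ⟨w, hw, hwp⟩ := Finset.exists_mem_notMem_of_card_lt_card
        (s := (v :: q).toFinset) (t := {w ∈ U | G.Adj v w}) (by omega)
      rw [Finset.mem_filter] at hw
      rw [List.mem_toFinset] at hwp
      refine ⟨w :: v :: q, by simpa using hlen, ?_, List.nodup_cons.2 ⟨hwp, hnodup⟩, ?_⟩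
      · exact List.isChain_cons_cons.2 ⟨hw.2.symm, hchain⟩
      · intro x hx
        rcases List.mem_cons.1 hx with rfl | hx
        · exact hw.1
        · exact hmem x hx

theorem BroomFree.exists_degree_lt [Fintype V] (hfree : BroomFree ℓ s G) (hℓ : 2 ≤ ℓ)
    {U : Finset V} (hU : U.Nonempty) : ∃ v ∈ U, #{w ∈ U | G.Adj v w} < ℓ + s := by
  by_contra! hcon
  obtain ⟨p, hlen, hchain, hnodup, hmem⟩ :=
    exists_path_of_minDegree hU hcon (ℓ - 2) (by omega)
  have hne : p ≠ [] := by rintro rfl; simp at hlen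
  refine not_broomFree_of_path hne hchain hnodup (by omega) ?_ hfree
  refine (hcon _ (hmem _ (List.getLast_mem hne))).trans (Finset.card_le_card ?_)
  exact Finset.filter_subset_filter _ (Finset.subset_univ _)

theorem BroomFree.sum_degree_le [Fintype V] (hfree : BroomFree ℓ s G) (hℓ : 2 ≤ ℓ)
    (U : Finset V) : ∑ v ∈ U, #{w ∈ U | G.Adj v w} ≤ 2 * (ℓ + s) * #U := by
  induction U using Finset.strongInduction with
  | H U ih =>
    rcases U.eq_empty_or_nonempty with rfl | hU
    · simp
    obtain ⟨v, hv, hdeg⟩ := hfree.exists_degree_lt hℓ hU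
    have h1 := ih (U.erase v) (Finset.erase_ssubset hv)
    have hc := Finset.card_erase_add_one hv
    have hsplit : ∀ x, #{w ∈ U | G.Adj x w}
        = #{w ∈ U.erase v | G.Adj x w} + if G.Adj x v then 1 else 0 := by
      intro x
      rw [Finset.card_filter, Finset.card_filter, Finset.sum_erase_add _ _ hv]
    have hsym : ∑ x ∈ U.erase v, (if G.Adj x v then 1 else 0) ≤ #{w ∈ U | G.Adj v w} := by
      rw [← Finset.card_filter]
      apply Finset.card_le_card
      intro x hx
      simp only [Finset.mem_filter, Finset.mem_erase] at hx ⊢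
      exact ⟨hx.1.2, hx.2.symm⟩
    have h2 : ∑ x ∈ U.erase v, #{w ∈ U | G.Adj x w}
        = ∑ x ∈ U.erase v, #{w ∈ U.erase v | G.Adj x w}
          + ∑ x ∈ U.erase v, (if G.Adj x v then 1 else 0) := by
      rw [← Finset.sum_add_distrib]
      exact Finset.sum_congr rfl fun x _ => hsplit x
    rw [← Finset.sum_erase_add _ _ hv, h2, ← hc]
    nlinarith

/-- Alternating path through prescribed vertices `c :: cs`, which are joined completely to `W`. -/
theorem exists_alternating_path {W : Finset V} (cs : List V) :
    ∀ (c : V) (F : Finset V), (c :: cs).Nodup → (∀ x ∈ c :: cs, ∀ w ∈ W, G.Adj x w) →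
      cs.length + #F ≤ #W →
      ∃ (q : List V), (c :: q).IsChain G.Adj ∧ (c :: q).Nodup ∧
        q.length = 2 * cs.length ∧ (c :: q).getLast (List.cons_ne_nil _ _) ∈ c :: cs ∧
        ∀ x ∈ c :: q, x ∈ c :: cs ∨ (x ∈ W ∧ x ∉ F) := by
  induction cs with
  | nil =>
    intro c F _ _ _
    exact ⟨[], by simp⟩
  | cons c' cs ih =>
    intro c F hnodup hadj hcard
    rw [List.length_cons] at hcard
    obtain ⟨w, hw, hwF⟩ := Finset.exists_mem_notMem_of_card_lt_card
      (s := F) (t := W) (by omega)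
    have hW : ∀ x ∈ c :: c' :: cs, x ∉ W := fun x hx hxW => G.irrefl (hadj x hx x hxW)
    obtain ⟨q, hchain, hqnodup, hlen, hlast, hmem⟩ := ih c' (insert w F)
      (List.nodup_cons.1 hnodup).2 (fun x hx => hadj x (List.mem_cons_of_mem _ hx))
      (by rw [Finset.card_insert_of_notMem hwF]; omega)
    refine ⟨w :: c' :: q, ?_, ?_, ?_, ?_, ?_⟩
    · exact List.isChain_cons_cons.2 ⟨hadj c (by simp) w hw,
        List.isChain_cons_cons.2 ⟨(hadj c' (by simp) w hw).symm, hchain⟩⟩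
    · have hwq : w ∉ c' :: q := by
        intro h
        rcases hmem w h with h | h
        · exact hW w (List.mem_cons_of_mem _ h) hw
        · exact h.2 (Finset.mem_insert_self _ _)
      have hcq : c ∉ c' :: q := by
        intro h
        rcases hmem c h with h | h
        · exact (List.nodup_cons.1 hnodup).1 h
        · exact hW c (by simp) h.1
      have hcw : c ≠ w := (hadj c (by simp) w hw).ne
      refine List.nodup_cons.2 ⟨?_, List.nodup_cons.2 ⟨hwq, hqnodup⟩⟩
      rw [List.mem_cons]
      rintro (h | h)
      · exact hcw h
      · exact hcq h
    · simp [hlen]; ring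
    · rw [List.getLast_cons (List.cons_ne_nil _ _), List.getLast_cons (List.cons_ne_nil _ _)]
      exact List.mem_cons_of_mem _ hlast
    · intro x hx
      rcases List.mem_cons.1 hx with rfl | hx
      · simp
      rcases List.mem_cons.1 hx with rfl | hx
      · exact Or.inr ⟨hw, hwF⟩
      rcases hmem x hx with h | h
      · exact Or.inl (List.mem_cons_of_mem _ h)
      · exact Or.inr ⟨h.1, fun hF => h.2 (Finset.mem_insert_of_mem hF)⟩

theorem BroomFree.card_commonNeighbors_lt [Fintype V] (hfree : BroomFree ℓ s G) {k : ℕ}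
    (hℓ : ℓ = 2 * k + 2) {T : Finset V} (hT : #T = k + 1) :
    #{w | ∀ a ∈ T, G.Adj a w} < ℓ + s := by
  by_contra! hcon
  have hTl := Finset.length_toList T
  have hTn := Finset.nodup_toList T
  have hTm : ∀ x, x ∈ T.toList → x ∈ T := fun x => Finset.mem_toList.1
  match h : T.toList with
  | [] => rw [h] at hTl; simp at hTl; omega
  | c :: cs =>
    rw [h] at hTl hTn hTm
    rw [List.length_cons] at hTl
    have hadj : ∀ x ∈ c :: cs, ∀ w ∈ ({w | ∀ a ∈ T, G.Adj a w} : Finset V), G.Adj x w := by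
      intro x hx w hw
      exact (Finset.mem_filter.1 hw).2 x (hTm x hx)
    obtain ⟨q, hchain, hnodup, hlen, hlast, -⟩ := exists_alternating_path cs c ∅ hTn hadj
      (by rw [Finset.card_empty]; omega)
    refine not_broomFree_of_path (List.cons_ne_nil _ _) hchain hnodup
      (by rw [List.length_cons]; omega) (hcon.trans (Finset.card_le_card ?_)) hfree
    intro w hw
    exact Finset.mem_filter.2 ⟨Finset.mem_univ _, hadj _ hlast w hw⟩

theorem BroomFree.not_adj_of_adj [Fintype V] (hfree : BroomFree ℓ s G) {k : ℕ}
    (hℓ : ℓ = 2 * k + 2) {K : Finset V} (hK : #K = k)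
    (hW : ℓ + s ≤ #{w | ∀ a ∈ K, G.Adj a w}) {u v c : V} (hu : u ∉ K) (hv : v ∉ K)
    (huv : G.Adj u v) (hc : c ∈ K) : ¬ G.Adj v c := by
  intro hvc
  have hl := Finset.card_erase_add_one hc
  have hmemK : ∀ x ∈ c :: (K.erase c).toList, x ∈ K := by
    intro x hx
    rcases List.mem_cons.1 hx with rfl | hx
    · exact hc
    · exact Finset.mem_of_mem_erase (Finset.mem_toList.1 hx)
  have hadj : ∀ x ∈ c :: (K.erase c).toList,
      ∀ w ∈ ({w | ∀ a ∈ K, G.Adj a w} : Finset V), G.Adj x w := by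
    intro x hx w hw
    exact (Finset.mem_filter.1 hw).2 x (hmemK x hx)
  have hcn : (c :: (K.erase c).toList).Nodup :=
    List.nodup_cons.2 ⟨by simp, Finset.nodup_toList _⟩
  obtain ⟨q, hchain, hnodup, hlen, hlast, hmem⟩ :=
    exists_alternating_path (K.erase c).toList c {u, v} hcn hadj
      (by have := Finset.card_le_two (a := u) (b := v); rw [Finset.length_toList]; omega)
  have hout : ∀ x ∉ K, x ∈ ({u, v} : Finset V) → x ∉ c :: q := by
    intro x hx hx2 h
    rcases hmem x h with h | h
    · exact hx (hmemK x h)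
    · exact h.2 hx2
  have hnd : (u :: v :: c :: q).Nodup := by
    refine List.nodup_cons.2 ⟨?_, List.nodup_cons.2 ⟨hout v hv (by simp), hnodup⟩⟩
    rw [List.mem_cons]
    rintro (h | h)
    · exact huv.ne h
    · exact hout u hu (by simp) h
  refine not_broomFree_of_path (p := u :: v :: c :: q) (List.cons_ne_nil _ _)
    (List.isChain_cons_cons.2 ⟨huv, List.isChain_cons_cons.2 ⟨hvc, hchain⟩⟩) hnd
    (by rw [Finset.length_toList] at hlen; simp only [List.length_cons]; omega)
    (hW.trans (Finset.card_le_card ?_)) hfree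
  intro w hw
  rw [List.getLast_cons (List.cons_ne_nil _ _), List.getLast_cons (List.cons_ne_nil _ _)]
  exact Finset.mem_filter.2 ⟨Finset.mem_univ _, hadj _ hlast w hw⟩

end Embedding

section Counting

variable {V : Type*} [Fintype V] {G : SimpleGraph V} {ℓ s k r : ℕ}

theorem starCopyCount_eq_sum (G : SimpleGraph V) (r : ℕ) :
    starCopyCount G r = ∑ v, (#{w | G.Adj v w}).choose r := by
  rw [starCopyCount, Finset.card_filter, ← Finset.univ_product_univ, Finset.sum_product]
  refine Finset.sum_congr rfl fun v _ => ?_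
  rw [← Finset.card_filter, ← Finset.card_powersetCard]
  congr 1
  ext x
  simp only [Finset.mem_filter, Finset.mem_univ, true_and, Finset.mem_powersetCard,
    Finset.subset_iff]
  exact and_comm

theorem card_neighbors_add_le {S : Finset V} {v : V} (hv : v ∉ S)
    (hS : ∀ x ∈ S, ¬ G.Adj v x) : #{w | G.Adj v w} + (#S + 1) ≤ Fintype.card V := by
  rw [← Finset.card_insert_of_notMem hv, ← Finset.card_univ, ← Finset.card_union_of_disjoint]
  · exact Finset.card_le_card (Finset.subset_univ _)
  · rw [Finset.disjoint_left]
    intro x hx hx2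
    have hx := (Finset.mem_filter.1 hx).2
    rcases Finset.mem_insert.1 hx2 with rfl | h
    · exact G.irrefl hx
    · exact hS x h hx

theorem choose_add_mul_choose_le (x q m : ℕ) :
    x.choose (q + 1) + m * x.choose q ≤ (x + m).choose (q + 1) := by
  induction m with
  | zero => simp
  | succ m ih =>
    have h1 : (x + (m + 1)).choose (q + 1) = (x + m).choose q + (x + m).choose (q + 1) :=
      Nat.choose_succ_succ _ _
    have h2 : x.choose q ≤ (x + m).choose q := Nat.choose_le_choose q (by omega)
    rw [h1]
    nlinarith

theorem mul_pow_add_choose_lt {n m D q : ℕ} (hq : q ≠ 0) (hD : 0 < D) (hm : 0 < m)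
    (hn : 2 * q < n) (hmn : 2 * (D * q.factorial + 1) * m ≤ n) :
    D * m ^ (q + 1) + (n - 1 - m).choose (q + 1) < (n - 1).choose (q + 1) := by
  have hDq : 1 ≤ D * q.factorial := Nat.mul_pos hD (Nat.factorial_pos q)
  have hlt : D * q.factorial * m < n - 1 - m + 1 - q := by
    have : 2 * (D * q.factorial + 1) * m = 2 * (D * q.factorial * m) + 2 * m := by ring
    omega
  have hle : m + 1 ≤ n := by nlinarith
  have h1 := choose_add_mul_choose_le (n - 1 - m) q m
  rw [show n - 1 - m + m = n - 1 by omega] at h1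
  have h2 : (D * q.factorial * m) ^ q < (n - 1 - m + 1 - q) ^ q := Nat.pow_lt_pow_left hlt hq
  have h3 := Nat.pow_sub_le_descFactorial (n - 1 - m) q
  rw [Nat.descFactorial_eq_factorial_mul_choose] at h3
  have h4 : D * q.factorial * m ^ q ≤ (D * q.factorial * m) ^ q := by
    rw [mul_pow]
    exact Nat.mul_le_mul_right _ (Nat.le_self_pow hq _)
  have h5 : D * m ^ q < (n - 1 - m).choose q := by
    have : q.factorial * (D * m ^ q) < q.factorial * (n - 1 - m).choose q := by
      calc q.factorial * (D * m ^ q) = D * q.factorial * m ^ q := by ring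
        _ < _ := by omega
    exact Nat.lt_of_mul_lt_mul_left this
  have h6 : m * (D * m ^ q) < m * (n - 1 - m).choose q := Nat.mul_lt_mul_of_pos_left h5 hm
  have h7 : D * m ^ (q + 1) = m * (D * m ^ q) := by ring
  omega

theorem choose_le_mul_pow {d m : ℕ} (hd : d ≤ m) (hr : 1 ≤ r) :
    d.choose r ≤ d * m ^ (r - 1) :=
  calc d.choose r ≤ d ^ r := Nat.choose_le_pow d r
    _ = d * d ^ (r - 1) := by rw [← pow_succ', Nat.sub_add_cancel hr]
    _ ≤ d * m ^ (r - 1) := Nat.mul_le_mul_left _ (Nat.pow_le_pow_left hd _)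

/-- If `k` vertices have large common neighbourhood, the extremal bound holds, and equality
determines the graph. -/
theorem BroomFree.starCopyCount_le_of_core (hfree : BroomFree ℓ s G) (hℓ : ℓ = 2 * k + 2)
    (hk : 1 ≤ k) (hr : 2 ≤ r) (hrn : r + 1 ≤ Fintype.card V) {K : Finset V} (hK : #K = k)
    (hW : ℓ + s ≤ #{w | ∀ a ∈ K, G.Adj a w})
    (hsmall : ∀ m, 0 < m → m + #{w | ∀ a ∈ K, G.Adj a w} ≤ Fintype.card V →
      2 * (ℓ + s) * m ^ r + (Fintype.card V - 1 - m).choose r < (Fintype.card V - 1).choose r) :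
    starCopyCount G r ≤ k * (Fintype.card V - 1).choose r + (Fintype.card V - k) * k.choose r ∧
    (starCopyCount G r = k * (Fintype.card V - 1).choose r + (Fintype.card V - k) * k.choose r →
      ∀ u v, G.Adj u v ↔ u ≠ v ∧ (u ∈ K ∨ v ∈ K)) := by
  set n := Fintype.card V with hn
  have hno : ∀ u ∉ K, ∀ v ∉ K, G.Adj u v → ∀ c ∈ K, ¬ G.Adj v c :=
    fun u hu v hv huv c hc => hfree.not_adj_of_adj hℓ hK hW hu hv huv hc
  set R : Finset V := {v | v ∉ K ∧ ∃ u ∉ K, G.Adj u v} with hR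
  have hmemR : ∀ v, v ∈ R ↔ v ∉ K ∧ ∃ u ∉ K, G.Adj u v := fun v => by simp [hR]
  have hRK : Disjoint K R := by
    rw [Finset.disjoint_left]
    intro v hv hv2
    exact ((hmemR v).1 hv2).1 hv
  have hRadj : ∀ v ∈ R, ∀ c ∈ K, ¬ G.Adj v c := by
    intro v hv c hc
    obtain ⟨hvK, u, hu, huv⟩ := (hmemR v).1 hv
    exact hno u hu v hvK huv c hc
  have hRW : #R + #{w | ∀ a ∈ K, G.Adj a w} ≤ n := by
    rw [← Finset.card_union_of_disjoint]
    · exact Finset.card_le_univ _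
    · rw [Finset.disjoint_left]
      intro v hv hv2
      obtain ⟨c, hc⟩ := Finset.card_pos.1 (by omega : 0 < #K)
      exact hRadj v hv c hc ((Finset.mem_filter.1 hv2).2 c hc).symm
  have hsplit : starCopyCount G r = ∑ v ∈ K, (#{w | G.Adj v w}).choose r
      + ∑ v ∈ R, (#{w | G.Adj v w}).choose r
      + ∑ v ∈ (K ∪ R)ᶜ, (#{w | G.Adj v w}).choose r := by
    rw [starCopyCount_eq_sum, ← Finset.sum_union hRK, Finset.sum_add_sum_compl]
  have hKterm : ∀ v ∈ K, (#{w | G.Adj v w}).choose r ≤ (n - 1 - #R).choose r := by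
    intro v hv
    apply Nat.choose_le_choose
    have := card_neighbors_add_le (G := G) (S := R) (v := v)
      (fun h => Finset.disjoint_left.1 hRK hv h) (fun x hx h => hRadj x hx v hv h.symm)
    omega
  have hKsum : ∑ v ∈ K, (#{w | G.Adj v w}).choose r ≤ k * (n - 1 - #R).choose r := by
    have := Finset.sum_le_card_nsmul _ _ _ hKterm
    rwa [hK, smul_eq_mul] at this
  have hIsum : ∑ v ∈ (K ∪ R)ᶜ, (#{w | G.Adj v w}).choose r ≤ (n - k) * k.choose r := by
    have h1 : ∀ v ∈ (K ∪ R)ᶜ, (#{w | G.Adj v w}).choose r ≤ k.choose r := by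
      intro v hv
      apply Nat.choose_le_choose
      rw [← hK]
      apply Finset.card_le_card
      intro w hw
      simp only [Finset.mem_compl, Finset.mem_union, not_or, hmemR] at hv
      by_contra hwK
      exact hv.2 ⟨hv.1, w, hwK, (Finset.mem_filter.1 hw).2.symm⟩
    have h2 := Finset.sum_le_card_nsmul _ _ _ h1
    rw [smul_eq_mul, Finset.card_compl, Finset.card_union_of_disjoint hRK, hK] at h2
    exact h2.trans (Nat.mul_le_mul_right _ (by omega))
  have hRsum : ∑ v ∈ R, (#{w | G.Adj v w}).choose r ≤ 2 * (ℓ + s) * #R ^ r := by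
    have hdeg : ∀ v ∈ R, #{w | G.Adj v w} = #{w ∈ R | G.Adj v w} := by
      intro v hv
      congr 1
      ext w
      simp only [Finset.mem_filter, Finset.mem_univ, true_and]
      refine ⟨fun h => ⟨?_, h⟩, fun h => h.2⟩
      exact (hmemR w).2 ⟨fun hw => hRadj v hv w hw h, v, ((hmemR v).1 hv).1, h⟩
    calc ∑ v ∈ R, (#{w | G.Adj v w}).choose r
        ≤ ∑ v ∈ R, #{w ∈ R | G.Adj v w} * #R ^ (r - 1) := by
          refine Finset.sum_le_sum fun v hv => ?_
          rw [hdeg v hv]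
          exact choose_le_mul_pow (Finset.card_le_card (Finset.filter_subset _ _)) (by omega)
      _ = (∑ v ∈ R, #{w ∈ R | G.Adj v w}) * #R ^ (r - 1) := (Finset.sum_mul _ _ _).symm
      _ ≤ 2 * (ℓ + s) * #R * #R ^ (r - 1) :=
          Nat.mul_le_mul_right _ (hfree.sum_degree_le (by omega) R)
      _ = 2 * (ℓ + s) * #R ^ r := by
          rw [mul_assoc, ← pow_succ', Nat.sub_add_cancel (by omega)]
  rcases Nat.eq_zero_or_pos #R with h0 | hpos
  · rw [h0, Nat.sub_zero] at hKsum hKterm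
    rw [h0, zero_pow (by omega), mul_zero] at hRsum
    refine ⟨by omega, fun heq => ?_⟩
    have hKeq : ∑ v ∈ K, (#{w | G.Adj v w}).choose r = ∑ v ∈ K, (n - 1).choose r := by
      rw [Finset.sum_const, hK, smul_eq_mul]
      omega
    have hfull : ∀ c ∈ K, ∀ v, v ≠ c → G.Adj c v := by
      intro c hc v hv
      by_contra hcv
      have h1 := card_neighbors_add_le (G := G) (S := {v}) (v := c)
        (by simpa using hv.symm) (by simpa using hcv)
      rw [Finset.card_singleton] at h1
      have h2 := (Finset.sum_eq_sum_iff_of_le hKterm).1 hKeq c hc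
      have h3 : (#{w | G.Adj c w}).choose r ≤ (n - 2).choose r :=
        Nat.choose_le_choose r (by omega)
      have h4 := Nat.choose_succ_succ (n - 2) (r - 1)
      have h5 : 0 < (n - 2).choose (r - 1) := Nat.choose_pos (by omega)
      simp only [Nat.succ_eq_add_one] at h4
      rw [show n - 2 + 1 = n - 1 by omega, show r - 1 + 1 = r by omega] at h4
      omega
    intro u v
    constructor
    · intro h
      refine ⟨h.ne, ?_⟩
      by_contra! hcon
      have : v ∈ R := (hmemR v).2 ⟨hcon.2, u, hcon.1, h⟩
      rw [Finset.card_eq_zero.1 h0] at this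
      simp at this
    · rintro ⟨hne, h | h⟩
      · exact hfull u h v hne.symm
      · exact (hfull v h u hne).symm
  · have h1 := hsmall _ hpos hRW
    have h2 : k * (2 * (ℓ + s) * #R ^ r + (n - 1 - #R).choose r) < k * (n - 1).choose r :=
      Nat.mul_lt_mul_of_pos_left h1 (by omega)
    have h3 : 2 * (ℓ + s) * #R ^ r ≤ k * (2 * (ℓ + s) * #R ^ r) :=
      Nat.le_mul_of_pos_left _ (by omega)
    rw [mul_add] at h2
    have h4 : starCopyCount G r < k * (n - 1).choose r + (n - k) * k.choose r := by omega
    exact ⟨h4.le, fun h => absurd h h4.ne⟩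

end Counting

section Stability

/-- Weights bounded by `n` with sum about `k n` and sum of squares about `k n²` contain `k`
weights close to `n`. -/
theorem le_card_filter_of_sum_sq {ι : Type*} {k : ℕ} {A : Finset ι} {d : ι → ℝ} {n η δ : ℝ} (hn : 0 < n)
    (hη : 0 < η) (hδ : 4 * η ≤ δ) (hδ1 : δ ≤ 1) (hd0 : ∀ v, 0 ≤ d v) (hdn : ∀ v, d v ≤ n)
    (hsq : (k - η) * n ^ 2 ≤ ∑ v ∈ A, d v ^ 2) (hsum : ∑ v ∈ A, d v ≤ (k + η) * n) :
    k ≤ #{v ∈ A | (1 - δ) * n ≤ d v} := by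
  by_contra! hlt
  have hlt' : (#{v ∈ A | (1 - δ) * n ≤ d v} : ℝ) + 1 ≤ k := by exact_mod_cast hlt
  have e1 := Finset.sum_filter_add_sum_filter_not A (fun v => (1 - δ) * n ≤ d v)
    (fun v => d v ^ 2)
  have e2 := Finset.sum_filter_add_sum_filter_not A (fun v => (1 - δ) * n ≤ d v) d
  have b1 : ∑ v ∈ A with (1 - δ) * n ≤ d v, d v ^ 2
      ≤ #{v ∈ A | (1 - δ) * n ≤ d v} * n ^ 2 := by
    rw [← nsmul_eq_mul]
    exact Finset.sum_le_card_nsmul _ _ _ fun v _ => pow_le_pow_left₀ (hd0 v) (hdn v) 2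
  have b2 : ∑ v ∈ A with (1 - δ) * n ≤ d v, d v ^ 2
      ≤ n * ∑ v ∈ A with (1 - δ) * n ≤ d v, d v := by
    rw [Finset.mul_sum]
    refine Finset.sum_le_sum fun v _ => ?_
    nlinarith [hd0 v, hdn v]
  have b3 : ∑ v ∈ A with ¬ (1 - δ) * n ≤ d v, d v ^ 2
      ≤ (1 - δ) * n * ∑ v ∈ A with ¬ (1 - δ) * n ≤ d v, d v := by
    rw [Finset.mul_sum]
    refine Finset.sum_le_sum fun v hv => ?_
    have := (Finset.mem_filter.1 hv).2
    nlinarith [hd0 v]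
  have b4 : ∑ v ∈ A with ¬ (1 - δ) * n ≤ d v, d v ^ 2
      ≤ n * ∑ v ∈ A with ¬ (1 - δ) * n ≤ d v, d v := by
    rw [Finset.mul_sum]
    refine Finset.sum_le_sum fun v _ => ?_
    nlinarith [hd0 v, hdn v]
  have hn2 : 0 < n ^ 2 := by positivity
  have c1 : (1 - η) * n ^ 2 ≤ n * ∑ v ∈ A with ¬ (1 - δ) * n ≤ d v, d v := by
    have := mul_le_mul_of_nonneg_right hlt' hn2.le
    nlinarith
  have c2 : (k - η) * n ^ 2 ≤ n * ((k + η) * n)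
      - δ * (n * ∑ v ∈ A with ¬ (1 - δ) * n ≤ d v, d v) := by
    have := mul_le_mul_of_nonneg_left hsum hn.le
    rw [← e2] at this
    nlinarith
  have c3 := mul_le_mul_of_nonneg_left c1 (by linarith : 0 ≤ δ)
  have c4 : (δ * (1 - η)) * n ^ 2 ≤ (2 * η) * n ^ 2 := by nlinarith
  have c5 := le_of_mul_le_mul_right c4 hn2
  nlinarith

variable {V : Type*} [Fintype V] {G : SimpleGraph V} {ℓ s k r : ℕ}

/-- Many stars force a large sum of squared degrees. -/
theorem le_sum_sq_degree (hr : 2 ≤ r) (hrn : r ≤ Fintype.card V) (hV : 0 < Fintype.card V)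
    (hcount : k * (Fintype.card V - 1).choose r ≤ starCopyCount G r) :
    (k : ℝ) * (Fintype.card V : ℝ) ^ 2 - k * r ^ 2 * Fintype.card V
      ≤ ∑ v, (#{w | G.Adj v w} : ℝ) ^ 2 := by
  set n := Fintype.card V with hn
  have h1 : k * (n - r) ^ r ≤ (∑ v, #{w | G.Adj v w} ^ 2) * n ^ (r - 2) := by
    calc k * (n - r) ^ r ≤ k * (r.factorial * (n - 1).choose r) := by
          refine Nat.mul_le_mul_left _ ?_
          have := Nat.pow_sub_le_descFactorial (n - 1) r
          rwa [Nat.descFactorial_eq_factorial_mul_choose, Nat.sub_add_cancel hV] at this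
      _ = r.factorial * (k * (n - 1).choose r) := by ring
      _ ≤ r.factorial * starCopyCount G r := Nat.mul_le_mul_left _ hcount
      _ = ∑ v, r.factorial * (#{w | G.Adj v w}).choose r := by
          rw [starCopyCount_eq_sum, Finset.mul_sum]
      _ ≤ ∑ v, #{w | G.Adj v w} ^ 2 * n ^ (r - 2) := by
          refine Finset.sum_le_sum fun v _ => ?_
          rw [← Nat.descFactorial_eq_factorial_mul_choose]
          refine (Nat.descFactorial_le_pow _ _).trans ?_
          calc #{w | G.Adj v w} ^ r = #{w | G.Adj v w} ^ 2 * #{w | G.Adj v w} ^ (r - 2) := by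
                rw [← pow_add, Nat.add_sub_cancel' hr]
            _ ≤ _ := Nat.mul_le_mul_left _ (Nat.pow_le_pow_left (Finset.card_le_univ _) _)
      _ = _ := (Finset.sum_mul _ _ _).symm
  have h2 : (k : ℝ) * ((n : ℝ) - r) ^ r
      ≤ (∑ v, (#{w | G.Adj v w} : ℝ) ^ 2) * (n : ℝ) ^ (r - 2) := by
    rw [← Nat.cast_sub hrn]
    exact_mod_cast h1
  have hn0 : (0 : ℝ) < n := by exact_mod_cast hV
  have hb := one_add_mul_le_pow (a := -((r : ℝ) / n)) (by
    have : (r : ℝ) / n ≤ 1 := (div_le_one hn0).2 (by exact_mod_cast hrn)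
    linarith) r
  have h3 : ((n : ℝ) - r) ^ r = (n : ℝ) ^ 2 * (n : ℝ) ^ (r - 2) * (1 + -((r : ℝ) / n)) ^ r := by
    rw [← pow_add, Nat.add_sub_cancel' hr, ← mul_pow]
    congr 1
    field_simp
    ring
  have hp : (0 : ℝ) < (n : ℝ) ^ (r - 2) := by positivity
  refine le_of_mul_le_mul_right (le_trans ?_ h2) hp
  rw [h3]
  calc ((k : ℝ) * (n : ℝ) ^ 2 - k * r ^ 2 * n) * (n : ℝ) ^ (r - 2)
      = k * ((n : ℝ) ^ 2 * (n : ℝ) ^ (r - 2) * (1 + r * -((r : ℝ) / n))) := by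
        field_simp
        ring
    _ ≤ _ := by gcongr

/-- Almost all vertices have at most `k` neighbours in a bounded set, so the degrees in this set
sum to little more than `k n`. -/
theorem BroomFree.sum_degree_le_of_card_le (hfree : BroomFree ℓ s G) (hℓ : ℓ = 2 * k + 2)
    (A : Finset V) :
    ∑ v ∈ A, #{w | G.Adj v w} ≤ k * Fintype.card V + #A * (2 ^ #A * (ℓ + s)) := by
  set B : Finset V := {w | k < #{a ∈ A | G.Adj a w}} with hB
  have hBcard : #B ≤ 2 ^ #A * (ℓ + s) := by
    have hsub : B ⊆ (A.powersetCard (k + 1)).biUnion fun T => {w | ∀ a ∈ T, G.Adj a w} := by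
      intro w hw
      have hw : k + 1 ≤ #{a ∈ A | G.Adj a w} := (Finset.mem_filter.1 hw).2
      obtain ⟨T, hT, hTc⟩ := Finset.exists_subset_card_eq hw
      refine Finset.mem_biUnion.2 ⟨T, Finset.mem_powersetCard.2
        ⟨hT.trans (Finset.filter_subset _ _), hTc⟩, Finset.mem_filter.2 ⟨Finset.mem_univ _, ?_⟩⟩
      exact fun a ha => (Finset.mem_filter.1 (hT ha)).2
    refine (Finset.card_le_card hsub).trans ((Finset.card_biUnion_le_card_mul _ _ (ℓ + s) ?_).trans
      (Nat.mul_le_mul_right _ ?_))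
    · exact fun T hT => (hfree.card_commonNeighbors_lt hℓ (Finset.mem_powersetCard.1 hT).2).le
    · rw [← Finset.card_powerset]
      exact Finset.card_le_card fun T hT =>
        Finset.mem_powerset.2 (Finset.mem_powersetCard.1 hT).1
  have hswap : ∑ v ∈ A, #{w | G.Adj v w} = ∑ w, #{a ∈ A | G.Adj a w} := by
    simp only [Finset.card_filter]
    exact Finset.sum_comm
  have hterm : ∀ w, #{a ∈ A | G.Adj a w} ≤ k + if w ∈ B then #A else 0 := by
    intro w
    split_ifs with h
    · exact (Finset.card_le_card (Finset.filter_subset _ _)).trans (Nat.le_add_left _ _)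
    · simpa [hB] using h
  calc ∑ v ∈ A, #{w | G.Adj v w} = ∑ w, #{a ∈ A | G.Adj a w} := hswap
    _ ≤ ∑ w, (k + if w ∈ B then #A else 0) := Finset.sum_le_sum fun w _ => hterm w
    _ = k * Fintype.card V + #A * #B := by
        rw [Finset.sum_add_distrib, Finset.sum_const, ← Finset.sum_filter, Finset.sum_const]
        simp [mul_comm]
    _ ≤ _ := by gcongr

/-- The number of vertices outside the common neighbourhood of a set of vertices of degree at
least `(1 - δ) n`. -/
theorem card_sub_card_commonNeighbors_le {K : Finset V} {δ : ℝ}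
    (hK : ∀ v ∈ K, (1 - δ) * Fintype.card V ≤ (#{w | G.Adj v w} : ℝ)) :
    (Fintype.card V : ℝ) - #{w | ∀ a ∈ K, G.Adj a w} ≤ #K * (δ * Fintype.card V) := by
  have hsub : (({w | ∀ a ∈ K, G.Adj a w} : Finset V))ᶜ
      ⊆ K.biUnion fun a => ({w | G.Adj a w} : Finset V)ᶜ := by
    intro w hw
    simp only [Finset.mem_compl, Finset.mem_filter, Finset.mem_univ, true_and,
      Finset.mem_biUnion] at hw ⊢
    push Not at hw
    exact hw
  have h1 := (Finset.card_le_card hsub).trans Finset.card_biUnion_le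
  have h2 : ((#(({w | ∀ a ∈ K, G.Adj a w} : Finset V))ᶜ : ℕ) : ℝ)
      ≤ ∑ a ∈ K, (#(({w | G.Adj a w} : Finset V))ᶜ : ℝ) := by exact_mod_cast h1
  have hc : ∀ S : Finset V, (#Sᶜ : ℝ) = Fintype.card V - #S := by
    intro S
    rw [Finset.card_compl, Nat.cast_sub (Finset.card_le_univ _)]
  rw [hc] at h2
  refine h2.trans ?_
  rw [← nsmul_eq_mul]
  refine Finset.sum_le_card_nsmul _ _ _ fun a ha => ?_
  rw [hc]
  linarith [hK a ha]

/-- In a large broom-free graph with as many stars as the extremal graph, some `k` vertices are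
jointly adjacent to almost everything. -/
theorem exists_core (ℓ s k r M : ℕ) (hℓ : ℓ = 2 * k + 2) (hk : 1 ≤ k) (hr : 2 ≤ r) (hM : 1 ≤ M) :
    ∃ N : ℕ, ∀ (V : Type) [Fintype V] (G : SimpleGraph V), N ≤ Fintype.card V →
      BroomFree ℓ s G → k * (Fintype.card V - 1).choose r ≤ starCopyCount G r →
      ∃ K : Finset V, #K = k ∧
        M * (Fintype.card V - #{w | ∀ a ∈ K, G.Adj a w}) ≤ Fintype.card V := by
  have hk0 : (1 : ℝ) ≤ k := by exact_mod_cast hk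
  have hM0 : (1 : ℝ) ≤ M := by exact_mod_cast hM
  set D : ℝ := (ℓ : ℝ) + s with hD
  have hD0 : 0 < D := by
    have : (0 : ℝ) ≤ s := Nat.cast_nonneg s
    rw [hD, hℓ]; push_cast; linarith
  set δ : ℝ := 1 / (k * M) with hδ
  have hδ0 : 0 < δ := by positivity
  have hδ1 : δ ≤ 1 := by
    rw [hδ, div_le_one (by positivity)]
    nlinarith
  set η : ℝ := δ / 4 with hη
  have hη0 : 0 < η := by positivity
  set ε : ℝ := η / (4 * D) with hε
  have hε0 : 0 < ε := by positivity
  set a : ℕ := ⌈2 * D / ε⌉₊ with ha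
  set C : ℕ := a * (2 ^ a * (ℓ + s)) with hC
  refine ⟨max (r + 1) (max ⌈C / η⌉₊ ⌈2 * (k * r ^ 2) / η⌉₊), ?_⟩
  intro V _ G hN hfree hcount
  set n := Fintype.card V with hn
  have hrn : r + 1 ≤ n := (le_max_left _ _).trans hN
  have hN1 : C / η ≤ (n : ℝ) :=
    (Nat.le_ceil _).trans (by
      exact_mod_cast (le_max_left _ _).trans ((le_max_right _ _).trans hN))
  have hN2 : 2 * (k * r ^ 2) / η ≤ (n : ℝ) :=
    (Nat.le_ceil _).trans (by
      exact_mod_cast (le_max_right _ _).trans ((le_max_right _ _).trans hN))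
  rw [div_le_iff₀ hη0] at hN1 hN2
  have hn0 : (0 : ℝ) < n := by exact_mod_cast (by omega : 0 < n)
  have hsq := le_sum_sq_degree (k := k) hr (by omega) (by omega) hcount
  rw [← hn] at hsq
  set d : V → ℝ := fun v => (#{w | G.Adj v w} : ℝ) with hd
  have hd0 : ∀ v, 0 ≤ d v := fun v => Nat.cast_nonneg _
  have hdn : ∀ v, d v ≤ n := fun v => Nat.cast_le.2 (Finset.card_le_univ _)
  have htot : ∑ v, d v ≤ 2 * D * n := by
    have := hfree.sum_degree_le (by omega) Finset.univ
    rw [Finset.card_univ, ← hn] at this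
    simp only [hd, hD]
    exact_mod_cast this
  set A : Finset V := {v | ε * n ≤ d v} with hA
  have hAcard : #A ≤ a := by
    have h1 : (#A : ℝ) * (ε * n) ≤ 2 * D * n := by
      refine le_trans ?_ htot
      rw [← nsmul_eq_mul]
      refine (Finset.card_nsmul_le_sum A d (ε * n) fun v hv => (Finset.mem_filter.1 hv).2).trans ?_
      exact Finset.sum_le_sum_of_subset_of_nonneg (Finset.subset_univ _) fun v _ _ => hd0 v
    have h2 : (#A : ℝ) * ε ≤ 2 * D := by
      refine le_of_mul_le_mul_right ?_ hn0
      linarith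
    have h3 : (#A : ℝ) ≤ 2 * D / ε := (le_div_iff₀ hε0).2 h2
    exact_mod_cast h3.trans (Nat.le_ceil _)
  have hAsum : ∑ v ∈ A, d v ≤ (k + η) * n := by
    have h1 := hfree.sum_degree_le_of_card_le hℓ A
    have h2 : #A * (2 ^ #A * (ℓ + s)) ≤ C := by
      rw [hC]
      gcongr
      norm_num
    have h3 : ∑ v ∈ A, #{w | G.Adj v w} ≤ k * n + C := h1.trans (Nat.add_le_add_left h2 _)
    have h4 : ∑ v ∈ A, d v ≤ k * n + C := by
      simp only [hd]
      exact_mod_cast h3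
    linarith
  have hAsq : (k - η) * n ^ 2 ≤ ∑ v ∈ A, d v ^ 2 := by
    have e := Finset.sum_filter_add_sum_filter_not Finset.univ (fun v => ε * n ≤ d v)
      (fun v => d v ^ 2)
    have h1 : ∑ v with ¬ ε * n ≤ d v, d v ^ 2 ≤ ε * n * (2 * D * n) := by
      calc ∑ v with ¬ ε * n ≤ d v, d v ^ 2 ≤ ∑ v with ¬ ε * n ≤ d v, ε * n * d v := by
            refine Finset.sum_le_sum fun v hv => ?_
            have := (Finset.mem_filter.1 hv).2
            nlinarith [hd0 v]
        _ ≤ ∑ v, ε * n * d v :=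
            Finset.sum_le_sum_of_subset_of_nonneg (Finset.subset_univ _) fun v _ _ =>
              mul_nonneg (by positivity) (hd0 v)
        _ = ε * n * ∑ v, d v := (Finset.mul_sum _ _ _).symm
        _ ≤ _ := by gcongr
    have h2 : ε * n * (2 * D * n) = η / 2 * n ^ 2 := by
      rw [hε]
      field_simp
      ring
    have h3 : (k : ℝ) * r ^ 2 * n ≤ η / 2 * n ^ 2 := by nlinarith
    linarith
  obtain ⟨K, hKsub, hK⟩ := Finset.exists_subset_card_eq
    (le_card_filter_of_sum_sq hn0 hη0 (by linarith) hδ1 hd0 hdn hAsq hAsum)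
  refine ⟨K, hK, ?_⟩
  have h1 := card_sub_card_commonNeighbors_le (G := G) (K := K) (δ := δ)
    fun v hv => (Finset.mem_filter.1 (hKsub hv)).2
  rw [hK, ← hn] at h1
  have h2 : (M : ℝ) * (k * (δ * n)) = n := by
    rw [hδ]
    field_simp
  have h3 : (M : ℝ) * ((n : ℝ) - #{w | ∀ a ∈ K, G.Adj a w}) ≤ n := by
    exact (mul_le_mul_of_nonneg_left h1 (by positivity)).trans h2.le
  rw [← Nat.cast_sub (Finset.card_le_univ _)] at h3
  exact_mod_cast h3

/-- The extremal bound, with the structure of the graphs attaining it, for large graphs with at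
least `k * (n - 1).choose r` stars. -/
theorem exists_starCopyCount_le (ℓ s k r : ℕ) (hℓ : ℓ = 2 * k + 2) (hk : 1 ≤ k) (hr : 2 ≤ r) :
    ∃ N : ℕ, ∀ (V : Type) [Fintype V] (G : SimpleGraph V), N ≤ Fintype.card V →
      BroomFree ℓ s G → k * (Fintype.card V - 1).choose r ≤ starCopyCount G r →
      ∃ K : Finset V, #K = k ∧
        starCopyCount G r
          ≤ k * (Fintype.card V - 1).choose r + (Fintype.card V - k) * k.choose r ∧
        (starCopyCount G r
            = k * (Fintype.card V - 1).choose r + (Fintype.card V - k) * k.choose r →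
          ∀ u v, G.Adj u v ↔ u ≠ v ∧ (u ∈ K ∨ v ∈ K)) := by
  set M := 2 * (2 * (ℓ + s) * (r - 1).factorial + 1) with hM
  have hM2 : 2 ≤ M := by omega
  obtain ⟨N, hN⟩ := exists_core ℓ s k r M hℓ hk hr (by omega)
  refine ⟨max N (2 * (ℓ + s) + 2 * r), fun V _ G hn hfree hge => ?_⟩
  have hnN : N ≤ Fintype.card V := (le_max_left _ _).trans hn
  have hnD : 2 * (ℓ + s) + 2 * r ≤ Fintype.card V := (le_max_right _ _).trans hn
  obtain ⟨K, hK, hKW⟩ := hN V G hnN hfree hge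
  have hW : ℓ + s ≤ #{w | ∀ a ∈ K, G.Adj a w} := by
    have := Nat.mul_le_mul_right (Fintype.card V - #{w | ∀ a ∈ K, G.Adj a w}) hM2
    omega
  refine ⟨K, hK, hfree.starCopyCount_le_of_core hℓ hk hr (by omega) hK hW ?_⟩
  intro m hm hmW
  have hmn : M * m ≤ Fintype.card V := (Nat.mul_le_mul_left M (by omega)).trans hKW
  have := mul_pow_add_choose_lt (D := 2 * (ℓ + s)) (q := r - 1)
    (by omega) (by omega) hm (by omega) hmn
  rwa [Nat.sub_add_cancel (by omega)] at this

end Stability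

section Extremal

theorem starCopyCount_congr {V W : Type*} [Fintype V] [Fintype W] {G : SimpleGraph V}
    {H : SimpleGraph W} (φ : G ≃g H) (r : ℕ) : starCopyCount G r = starCopyCount H r := by
  rw [starCopyCount_eq_sum, starCopyCount_eq_sum, ← Equiv.sum_comp φ.toEquiv]
  refine Finset.sum_congr rfl fun v _ => ?_
  congr 1
  refine Finset.card_equiv φ.toEquiv fun w => ?_
  simp only [Finset.mem_filter, Finset.mem_univ, true_and]
  exact φ.map_adj_iff.symm

theorem Hgraph_adj {k n : ℕ} {a b : Fin n} :
    (Hgraph k n).Adj a b ↔ a ≠ b ∧ (a.val < k ∨ b.val < k) := by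
  rw [Hgraph, SimpleGraph.fromRel_adj]
  tauto

theorem card_filter_val_lt {k n : ℕ} (hkn : k ≤ n) : #{a : Fin n | a.val < k} = k := by
  rw [Fin.card_filter_val_lt, min_eq_right hkn]

theorem starCopyCount_Hgraph {k n : ℕ} (hkn : k ≤ n) (r : ℕ) :
    starCopyCount (Hgraph k n) r = k * (n - 1).choose r + (n - k) * k.choose r := by
  have h1 : ∀ v : Fin n, (#{w | (Hgraph k n).Adj v w}).choose r
      = if v.val < k then (n - 1).choose r else k.choose r := by
    intro v
    split_ifs with h
    · have : ({w | (Hgraph k n).Adj v w} : Finset (Fin n)) = {v}ᶜ := by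
        ext w
        simp [Hgraph_adj, h, eq_comm]
      rw [this, Finset.card_compl, Finset.card_singleton, Fintype.card_fin]
    · have : ({w | (Hgraph k n).Adj v w} : Finset (Fin n))
          = ({w | w.val < k} : Finset (Fin n)) := by
        ext w
        simp only [Finset.mem_filter, Finset.mem_univ, true_and, Hgraph_adj]
        constructor
        · tauto
        · intro hw
          exact ⟨by rintro rfl; exact h hw, Or.inr hw⟩
      rw [this, card_filter_val_lt hkn]
  rw [starCopyCount_eq_sum, Finset.sum_congr rfl fun v _ => h1 v, Finset.sum_ite,
    Finset.sum_const, Finset.sum_const, smul_eq_mul, smul_eq_mul, card_filter_val_lt hkn,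
    Finset.filter_not, Finset.card_sdiff_of_subset (Finset.filter_subset _ _),
    card_filter_val_lt hkn, Finset.card_univ, Fintype.card_fin]

theorem nonempty_iso_Hgraph {k n : ℕ} (hkn : k ≤ n) {G : SimpleGraph (Fin n)}
    {K : Finset (Fin n)} (hK : #K = k) (hG : ∀ u v, G.Adj u v ↔ u ≠ v ∧ (u ∈ K ∨ v ∈ K)) :
    Nonempty (G ≃g Hgraph k n) := by
  have hcard : Fintype.card {x // x ∈ K} = Fintype.card {x : Fin n // x.val < k} := by
    rw [Fintype.card_coe, hK, Fintype.card_subtype, card_filter_val_lt hkn]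
  set e := Fintype.equivOfCardEq hcard
  have hmem : ∀ x, (e.extendSubtype x).val < k ↔ x ∈ K := by
    intro x
    constructor
    · intro h
      by_contra hx
      exact e.extendSubtype_not_mem x hx h
    · exact fun h => e.extendSubtype_mem x h
  refine ⟨⟨e.extendSubtype, ?_⟩⟩
  intro u v
  rw [Hgraph_adj, hG, hmem, hmem, Ne, Ne, EmbeddingLike.apply_eq_iff_eq]

end Extremal

/-- For even `ℓ ≥ 4`, `k = (ℓ-2)/2`, `r ≥ 2` and all sufficiently large `n`, every
`n`-vertex `B(ℓ,s)`-free graph `G` contains at most `k·C(n-1,r) + (n-k)·C(k,r)`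
copies of `S_r`, with equality iff `G ≅ H(k,n)`. -/
theorem starCount_extremal_broom_even (ℓ s k r : ℕ) (hℓ : 4 ≤ ℓ) (heven : Even ℓ)
    (hk : k = (ℓ - 2) / 2) (hr : 2 ≤ r) :
    ∃ N : ℕ, ∀ n : ℕ, N ≤ n → ∀ G : SimpleGraph (Fin n), BroomFree ℓ s G →
      (starCopyCount G r ≤ k * (n - 1).choose r + (n - k) * k.choose r) ∧
      ((starCopyCount G r = k * (n - 1).choose r + (n - k) * k.choose r) ↔
        Nonempty (G ≃g Hgraph k n)) := by
  have hℓk : ℓ = 2 * k + 2 := by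
    obtain ⟨t, ht⟩ := heven
    omega
  have hk1 : 1 ≤ k := by omega
  obtain ⟨N, hN⟩ := exists_starCopyCount_le ℓ s k r hℓk hk1 hr
  refine ⟨max N k, fun n hn G hfree => ?_⟩
  have hkn : k ≤ n := (le_max_right _ _).trans hn
  have hiso : Nonempty (G ≃g Hgraph k n) →
      starCopyCount G r = k * (n - 1).choose r + (n - k) * k.choose r := by
    rintro ⟨φ⟩
    rw [starCopyCount_congr φ, starCopyCount_Hgraph hkn]
  rcases lt_or_ge (starCopyCount G r) (k * (n - 1).choose r) with hlt | hge
  · have hlt' := hlt.trans_le (Nat.le_add_right _ ((n - k) * k.choose r))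
    exact ⟨hlt'.le, fun h => absurd h hlt'.ne, hiso⟩
  have hmain := hN (Fin n) G
  rw [Fintype.card_fin] at hmain
  obtain ⟨K, hK, hle, hstruct⟩ := hmain ((le_max_left _ _).trans hn) hfree hge
  exact ⟨hle, fun h => nonempty_iso_Hgraph hkn hK (hstruct h), hiso⟩
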